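/- Boundedness of S_y^α for every y > 0 (second Proposition thmBound, case y > 0): let α > -1, β, η > 0, y > 0, and fix I ∈ ℍ with I² = -1. Then there exists a constant C > 0 such that for every measurable φ : (0,∞) → ℍ with ∫_0^∞ ‖φ(x)‖² x^α e^{-x} dx < ∞, ∫∫_{{u²+v²<1}} ‖S_y^α φ(u+vI)‖² ω_{β,η}(u²+v²) du dv ≤ C · ∫_0^∞ ‖φ(x)‖² x^α e^{-x} dx. -/

import Mathlib

open MeasureTheory Real Quaternion

/-- Generalized Laguerre polynomial `L_n^{(α)}(x)`. -/
noncomputable def genLaguerre (α : ℝ) (n : ℕ) (x : ℝ) : ℝ :=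
  ∑ k ∈ Finset.range (n + 1),
    ((-1 : ℝ) ^ k / (Nat.factorial k)) *
      (Real.Gamma (n + α + 1) / (Real.Gamma (k + α + 1) * (Nat.factorial (n - k)))) * x ^ k

/-- Normalized Laguerre function `φ_n^α(x)`. -/
noncomputable def lagPhi (α : ℝ) (n : ℕ) (x : ℝ) : ℝ :=
  Real.sqrt ((Nat.factorial n : ℝ) / Real.Gamma (n + α + 1)) * genLaguerre α n x

/-- Weight `ω_{β,η}(t) = t^{β-1}(1-t)^{η-1}`. -/
noncomputable def weightBeta (β η t : ℝ) : ℝ := t ^ (β - 1) * (1 - t) ^ (η - 1)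

/-- The kernel `R_q^α(x,y) = Σ_n qⁿ φ_n^α(x) φ_n^α(y)`. -/
noncomputable def Rker (α : ℝ) (q : ℍ[ℝ]) (x y : ℝ) : ℍ[ℝ] :=
  ∑' n : ℕ, (lagPhi α n x * lagPhi α n y) • q ^ n

/-- The dual transform `S_y^α φ(q) = ∫_0^∞ R_q^α(x,y) φ(x) x^α e^{-x} dx`. -/
noncomputable def Sdual (α y : ℝ) (φ : ℝ → ℍ[ℝ]) (q : ℍ[ℝ]) : ℍ[ℝ] :=
  ∫ x in Set.Ioi (0 : ℝ), (x ^ α * Real.exp (-x)) • (Rker α q x y * φ x)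


noncomputable def lagP (α : ℝ) (n : ℕ) (x : ℝ) : ℝ :=
  ∑ k ∈ Finset.range (n + 1), (-1 : ℝ) ^ k * (n.choose k) / Real.Gamma (k + α + 1) * x ^ k

noncomputable def lagH (α : ℝ) (n : ℕ) : ℝ := Real.Gamma (n + α + 1) / (Nat.factorial n)

lemma gam_pos {α : ℝ} (hα : -1 < α) (n : ℕ) : 0 < Real.Gamma (n + α + 1) := by
  apply Real.Gamma_pos_of_pos
  have : (0 : ℝ) ≤ n := Nat.cast_nonneg n
  linarith

lemma lagH_pos {α : ℝ} (hα : -1 < α) (n : ℕ) : 0 < lagH α n := by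
  have := gam_pos hα n
  unfold lagH
  positivity

lemma lagH_succ {α : ℝ} (hα : -1 < α) (n : ℕ) :
    lagH α (n + 1) = lagH α n * (n + 1 + α) / (n + 1) := by
  unfold lagH
  have h0 : (n : ℝ) + α + 1 ≠ 0 := by
    have : (0 : ℝ) ≤ n := Nat.cast_nonneg n
    linarith
  rw [show ((n + 1 : ℕ) : ℝ) + α + 1 = (n + α + 1) + 1 by push_cast; ring,
    Real.Gamma_add_one h0, Nat.factorial_succ]
  push_cast
  field_simp
  ring

lemma genLaguerre_eq {α : ℝ} (hα : -1 < α) (n : ℕ) (x : ℝ) :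
    genLaguerre α n x = lagH α n * lagP α n x := by
  unfold genLaguerre lagP lagH
  rw [Finset.mul_sum]
  refine Finset.sum_congr rfl fun k hk => ?_
  have hk' : k ≤ n := by simpa [Nat.lt_succ_iff] using hk
  have h1 := (gam_pos hα k).ne'
  rw [Nat.cast_choose ℝ hk']
  have h2 : (Nat.factorial n : ℝ) ≠ 0 := by positivity
  have h3 : (Nat.factorial k : ℝ) ≠ 0 := by positivity
  have h4 : (Nat.factorial (n - k) : ℝ) ≠ 0 := by positivity
  field_simp

lemma lagPhi_eq {α : ℝ} (hα : -1 < α) (n : ℕ) (x : ℝ) :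
    lagPhi α n x = √(lagH α n) * lagP α n x := by
  unfold lagPhi
  have h := lagH_pos hα n
  have : (Nat.factorial n : ℝ) / Real.Gamma (n + α + 1) = (lagH α n)⁻¹ := by
    unfold lagH; rw [inv_div]
  rw [this, genLaguerre_eq hα, Real.sqrt_inv, ← mul_assoc]
  congr 1
  have h5 : √(lagH α n) ≠ 0 := (Real.sqrt_pos.2 h).ne'
  field_simp
  exact (Real.sq_sqrt h.le).symm

lemma lagP_ext (α : ℝ) (n N : ℕ) (hN : n + 1 ≤ N) (x : ℝ) :
    lagP α n x = ∑ k ∈ Finset.range N,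
      (-1 : ℝ) ^ k * (n.choose k) / Real.Gamma (k + α + 1) * x ^ k := by
  unfold lagP
  apply Finset.sum_subset
  · intro k; simp; omega
  · intro k _ hk
    have : n < k := by simpa using hk
    simp [Nat.choose_eq_zero_of_lt this]

lemma lagP_rec {α : ℝ} (hα : -1 < α) (n : ℕ) (x : ℝ) :
    (n + 2 + α) * lagP α (n + 2) x
      = (2 * n + 3 + α - x) * lagP α (n + 1) x - (n + 1) * lagP α n x := by
  have hx : x * lagP α (n + 1) x = ∑ k ∈ Finset.range (n + 2),
      (-1 : ℝ) ^ k * ((n + 1).choose k) / Real.Gamma (k + α + 1) * x ^ (k + 1) := by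
    unfold lagP
    rw [Finset.mul_sum]
    refine Finset.sum_congr rfl fun k _ => by ring
  rw [sub_mul, hx, lagP_ext α (n + 2) (n + 2 + 1) (by omega),
    lagP_ext α (n + 1) (n + 2 + 1) (by omega), lagP_ext α n (n + 2 + 1) (by omega),
    Finset.sum_range_succ' _ (n + 2), Finset.sum_range_succ' _ (n + 2),
    Finset.sum_range_succ' _ (n + 2), mul_add, mul_add, mul_add, Finset.mul_sum, Finset.mul_sum,
    Finset.mul_sum]
  have key : ∀ k ∈ Finset.range (n + 2),
      ((n : ℝ) + 2 + α) * ((-1 : ℝ) ^ (k + 1) * ((n + 2).choose (k + 1)) /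
        Real.Gamma ((k + 1 : ℕ) + α + 1) * x ^ (k + 1)) =
      (2 * n + 3 + α) * ((-1 : ℝ) ^ (k + 1) * ((n + 1).choose (k + 1)) /
        Real.Gamma ((k + 1 : ℕ) + α + 1) * x ^ (k + 1))
      - (-1 : ℝ) ^ k * ((n + 1).choose k) / Real.Gamma (k + α + 1) * x ^ (k + 1)
      - (n + 1) * ((-1 : ℝ) ^ (k + 1) * (n.choose (k + 1)) /
        Real.Gamma ((k + 1 : ℕ) + α + 1) * x ^ (k + 1)) := by
    intro k _
    have h0 : (k : ℝ) + α + 1 ≠ 0 := by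
      have : (0 : ℝ) ≤ k := Nat.cast_nonneg k
      linarith
    have h1 := (gam_pos hα k).ne'
    rw [show ((k + 1 : ℕ) : ℝ) + α + 1 = (k + α + 1) + 1 by push_cast; ring,
      Real.Gamma_add_one h0]
    have e1 : (((n + 2).choose (k + 1) : ℕ) : ℝ)
        = (n + 1).choose k + (n + 1).choose (k + 1) := by
      exact_mod_cast Nat.choose_succ_succ (n + 1) k
    have e2 : (((n + 1).choose (k + 1) : ℕ) : ℝ) = n.choose k + n.choose (k + 1) := by
      exact_mod_cast Nat.choose_succ_succ n k
    have e3 : ((n : ℝ) + 1) * n.choose k = (n + 1).choose (k + 1) * (k + 1) := by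
      exact_mod_cast Nat.add_one_mul_choose_eq n k
    have e4 : ((n : ℝ) + 1 + 1) * (n + 1).choose k = (n + 2).choose (k + 1) * (k + 1) := by
      exact_mod_cast Nat.add_one_mul_choose_eq (n + 1) k
    have e5 : ((n : ℝ) + 2 + α) * (n + 2).choose (k + 1) =
        (2 * n + 3 + α) * (n + 1).choose (k + 1) + (k + α + 1) * (n + 1).choose k
        - (n + 1) * n.choose (k + 1) := by
      have e6 : (n.choose (k + 1) : ℝ) = (n + 1).choose (k + 1) - n.choose k := by linarith
      rw [e6]
      rw [e1] at e4 ⊢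
      linear_combination e4 - e3
    have : ((n : ℝ) + 2 + α) * ((-1 : ℝ) ^ (k + 1) * ((n + 2).choose (k + 1)) /
        ((k + α + 1) * Real.Gamma (k + α + 1)) * x ^ (k + 1)) =
        ((-1 : ℝ) ^ (k + 1) /
        ((k + α + 1) * Real.Gamma (k + α + 1)) * x ^ (k + 1)) * (((n : ℝ) + 2 + α) * (n + 2).choose (k + 1)) := by ring
    rw [this, e5]
    field_simp
    ring
  rw [Finset.sum_congr rfl key, Finset.sum_sub_distrib, Finset.sum_sub_distrib]
  simp
  ring

lemma lagPhi_rec {α : ℝ} (hα : -1 < α) (n : ℕ) (x : ℝ) :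
    √(((n : ℝ) + 2) * (n + 2 + α)) * lagPhi α (n + 2) x
      = (2 * n + 3 + α - x) * lagPhi α (n + 1) x
        - √(((n : ℝ) + 1) * (n + 1 + α)) * lagPhi α n x := by
  have hn : (0 : ℝ) ≤ n := Nat.cast_nonneg n
  have hH := lagH_pos hα
  have a1 : √(((n : ℝ) + 2) * (n + 2 + α)) * √(lagH α (n + 2)) = (n + 2 + α) * √(lagH α (n + 1)) := by
    rw [← Real.sqrt_mul (by apply mul_nonneg <;> linarith)]
    have : lagH α (n + 2) = lagH α (n + 1) * (n + 2 + α) / (n + 2) := by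
      rw [lagH_succ hα (n + 1)]; push_cast; ring
    rw [this, show ((n : ℝ) + 2) * (n + 2 + α) * (lagH α (n + 1) * (n + 2 + α) / (n + 2))
      = (n + 2 + α) ^ 2 * lagH α (n + 1) by field_simp, Real.sqrt_mul (by positivity),
      Real.sqrt_sq (by linarith)]
  have a2 : √(((n : ℝ) + 1) * (n + 1 + α)) * √(lagH α n) = (n + 1) * √(lagH α (n + 1)) := by
    rw [← Real.sqrt_mul (by apply mul_nonneg <;> linarith), lagH_succ hα n]
    rw [show (n + 1 : ℝ) * √(lagH α n * (n + 1 + α) / (n + 1)) =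
      √((n + 1) ^ 2 * (lagH α n * (n + 1 + α) / (n + 1))) by
        rw [Real.sqrt_mul (by positivity), Real.sqrt_sq (by linarith)]]
    congr 1
    field_simp
  simp only [lagPhi_eq hα]
  rw [← mul_assoc, a1, ← mul_assoc _ _ (lagP α n x), a2]
  linear_combination √(lagH α (n + 1)) * lagP_rec hα n x

lemma growth_bdd (E c : ℕ → ℝ) (n0 : ℕ) (hE : ∀ n, n0 ≤ n → 0 ≤ E n) (hc : ∀ n, 0 ≤ c n)
    (hs : Summable c) (h : ∀ n, n0 ≤ n → E (n + 1) ≤ (1 + c n) * E n) :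
    ∀ n, n0 ≤ n → E n ≤ E n0 * Real.exp (∑' n, c n) := by
  have key : ∀ k, E (n0 + k) ≤ E n0 * Real.exp (∑ i ∈ Finset.range (n0 + k), c i) := by
    intro k
    induction k with
    | zero =>
      have : (1 : ℝ) ≤ Real.exp (∑ i ∈ Finset.range (n0 + 0), c i) :=
        Real.one_le_exp (Finset.sum_nonneg fun i _ => hc i)
      have h0 := hE n0 le_rfl
      simp only [add_zero] at *
      nlinarith
    | succ k ih =>
      have h1 := h (n0 + k) (by omega)
      rw [← add_assoc, Finset.sum_range_succ, Real.exp_add]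
      have h2 : 1 + c (n0 + k) ≤ Real.exp (c (n0 + k)) := by
        have := Real.add_one_le_exp (c (n0 + k)); linarith
      calc E (n0 + k + 1) ≤ (1 + c (n0 + k)) * E (n0 + k) := h1
        _ ≤ Real.exp (c (n0 + k)) * (E n0 * Real.exp (∑ i ∈ Finset.range (n0 + k), c i)) := by
          apply mul_le_mul h2 ih (hE _ (by omega)) (Real.exp_pos _).le
        _ = _ := by ring
  intro n hn
  obtain ⟨k, rfl⟩ := Nat.exists_eq_add_of_le hn
  refine (key k).trans ?_
  apply mul_le_mul_of_nonneg_left _ (hE n0 le_rfl)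
  exact Real.exp_le_exp.2 (hs.sum_le_tsum _ fun i _ => hc i)

/-- One step of the discrete energy estimate. -/
lemma energy_step (y A B B' X u δ : ℝ) (hy : 0 < y) (hB1 : 1 ≤ B) (hBy : y ≤ B)
    (hBB : B ≤ B') (hB' : B' - B ≤ 1 + A) (hA : 0 ≤ A) (hδ0 : 0 ≤ δ) (hδ : δ ≤ A / B) :
    (X - y * u + δ * u) * (X + δ * u) / B' + y * u ^ 2 ≤
      (1 + ((y * (1 + A) + 2 * A) / √y + 2 * A ^ 2 / y) / (B * √B)) *
        (X * (X - y * u) / B + y * u ^ 2)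
    ∧ y * u ^ 2 ≤ 2 * (X * (X - y * u) / B + y * u ^ 2) := by
  have hB0 : 0 < B := by linarith
  have hB'0 : 0 < B' := by linarith
  set E := X * (X - y * u) / B + y * u ^ 2 with hEdef
  set s := X ^ 2 / B + y * u ^ 2 with hs
  have hsB : 0 < √B := Real.sqrt_pos.2 hB0
  have hsy : 0 < √y := Real.sqrt_pos.2 hy
  have qB : √B ^ 2 = B := Real.sq_sqrt hB0.le
  have qy : √y ^ 2 = y := Real.sq_sqrt hy.le
  have hXu : |X| * |u| * (2 * √y) ≤ s * √B := by
    have h1 : 0 ≤ (|X| / √B - √y * |u|) ^ 2 := sq_nonneg _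
    have h2 : (|X| / √B - √y * |u|) ^ 2 = s - |X| * |u| * (2 * √y) / √B := by
      rw [hs, sub_sq, div_pow, mul_pow, sq_abs, sq_abs, qB, qy]; ring
    rw [h2, sub_nonneg, div_le_iff₀ hsB] at h1
    exact h1
  have hs0 : 0 ≤ s := by positivity
  have hsyB : √y ≤ √B := Real.sqrt_le_sqrt hBy
  have hEs : s ≤ 2 * E := by
    have h1 : E = s - y * (X * u) / B := by rw [hEdef, hs]; ring
    have h3 : y * (X * u) / B ≤ s / 2 := by
      rw [div_le_iff₀ hB0]
      have h4 : X * u ≤ |X| * |u| := by rw [← abs_mul]; exact le_abs_self _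
      have h5 : y * (|X| * |u|) ≤ s / 2 * B := by
        have h6 : y * (|X| * |u|) * 2 ≤ s * √B * √y := by
          have h8 := mul_le_mul_of_nonneg_right hXu hsy.le
          have h9 : |X| * |u| * (2 * √y) * √y = y * (|X| * |u|) * 2 := by
            linear_combination 2 * |X| * |u| * qy
          linarith
        have h7 : s * √B * √y ≤ s * √B * √B := by gcongr
        have h8 : s * √B * √B = s * B := by linear_combination s * qB
        linarith
      exact (mul_le_mul_of_nonneg_left h4 hy.le).trans h5
    linarith
  have hE0 : 0 ≤ E := by linarith
  have hu : y * u ^ 2 ≤ s := by rw [hs]; have : 0 ≤ X ^ 2 / B := by positivity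
                                linarith
  refine ⟨?_, by linarith⟩
  have hdiff : (X - y * u + δ * u) * (X + δ * u) / B' + y * u ^ 2 - E
      = - X ^ 2 * (1 / B - 1 / B') + y * (X * u) * (1 / B - 1 / B')
        + δ * (2 * (X * u)) / B' - y * δ * u ^ 2 / B' + δ ^ 2 * u ^ 2 / B' := by
    rw [hEdef]; field_simp; ring
  have hinv0 : 0 ≤ 1 / B - 1 / B' := by
    rw [sub_nonneg]; exact one_div_le_one_div_of_le hB0 hBB
  have hinv : 1 / B - 1 / B' ≤ (1 + A) / B ^ 2 := by
    rw [div_sub_div _ _ hB0.ne' hB'0.ne', div_le_div_iff₀ (by positivity) (by positivity)]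
    have : B ^ 2 ≤ B * B' := by nlinarith
    nlinarith
  have hW : X * u ≤ |X| * |u| := by rw [← abs_mul]; exact le_abs_self _
  set W := |X| * |u| with hWdef
  have hW0 : 0 ≤ W := by positivity
  have t1 : - X ^ 2 * (1 / B - 1 / B') ≤ 0 := by nlinarith [sq_nonneg X]
  have t2 : y * (X * u) * (1 / B - 1 / B') ≤ y * W * ((1 + A) / B ^ 2) := by
    apply mul_le_mul _ hinv hinv0 (by positivity)
    exact mul_le_mul_of_nonneg_left hW hy.le
  have t3 : δ * (2 * (X * u)) / B' ≤ (A / B) * (2 * W) / B := by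
    calc δ * (2 * (X * u)) / B' ≤ δ * (2 * W) / B' := by gcongr
      _ ≤ (A / B) * (2 * W) / B := by gcongr
  have t4 : 0 ≤ y * δ * u ^ 2 / B' := by positivity
  have t5 : δ ^ 2 * u ^ 2 / B' ≤ (A / B) ^ 2 * (s / y) / B := by
    have : u ^ 2 ≤ s / y := by rw [le_div_iff₀ hy]; linarith
    gcongr
  have hWs : W ≤ s * √B / (2 * √y) := by rw [le_div_iff₀ (by positivity)]; exact hXu
  have t6 : y * W * ((1 + A) / B ^ 2) + (A / B) * (2 * W) / B
      ≤ ((y * (1 + A) + 2 * A) / √y) / (B * √B) * (s / 2) := by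
    have : y * W * ((1 + A) / B ^ 2) + (A / B) * (2 * W) / B
      = (y * (1 + A) + 2 * A) / B ^ 2 * W := by field_simp
    rw [this]
    calc (y * (1 + A) + 2 * A) / B ^ 2 * W
        ≤ (y * (1 + A) + 2 * A) / B ^ 2 * (s * √B / (2 * √y)) := by gcongr
      _ = (y * (1 + A) + 2 * A) * s / (2 * √y) * (√B / B ^ 2) := by ring
      _ = (y * (1 + A) + 2 * A) * s / (2 * √y) * (1 / (B * √B)) := by
          congr 1
          rw [div_eq_div_iff (by positivity) (by positivity)]
          linear_combination B * qB
      _ = _ := by ring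
  have t7 : (A / B) ^ 2 * (s / y) / B ≤ (2 * A ^ 2 / y) / (B * √B) * (s / 2) := by
    have h1 : √B ≤ B ^ 2 := by
      have : √B ≤ B := by
        rw [Real.sqrt_le_left hB0.le]; exact le_self_pow₀ hB1 (by norm_num)
      exact this.trans (le_self_pow₀ hB1 (by norm_num))
    have : (A / B) ^ 2 * (s / y) / B = A ^ 2 * s / y / (B * B ^ 2) := by field_simp
    rw [this, show (2 * A ^ 2 / y) / (B * √B) * (s / 2) = A ^ 2 * s / y / (B * √B) by ring]
    gcongr
  set K1 := (y * (1 + A) + 2 * A) / √y with hK1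
  set K2 := 2 * A ^ 2 / y with hK2
  have hK10 : 0 ≤ K1 := by positivity
  have hK20 : 0 ≤ K2 := by positivity
  have t8 : (K1 / (B * √B) + K2 / (B * √B)) * (s / 2) ≤ (K1 / (B * √B) + K2 / (B * √B)) * E := by
    apply mul_le_mul_of_nonneg_left (by linarith) (by positivity)
  rw [add_div]
  have t9 : (1 + (K1 / (B * √B) + K2 / (B * √B))) * E
      = E + (K1 / (B * √B) + K2 / (B * √B)) * E := by ring
  have t10 : (K1 / (B * √B) + K2 / (B * √B)) * (s / 2)
      = K1 / (B * √B) * (s / 2) + K2 / (B * √B) * (s / 2) := by ring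
  linarith

lemma lagPhi_bdd {α : ℝ} (hα : -1 < α) {y : ℝ} (hy : 0 < y) :
    ∃ M : ℝ, 0 ≤ M ∧ ∀ n, lagPhi α n y ^ 2 ≤ M := by
  set B : ℕ → ℝ := fun n => √(((n : ℝ) + 1) * (n + 1 + α)) with hB
  set u : ℕ → ℝ := fun n => lagPhi α (n + 1) y with hu
  set X : ℕ → ℝ := fun n => B n * (lagPhi α (n + 1) y - lagPhi α n y) with hX
  set δ : ℕ → ℝ := fun n => 2 * n + 3 + α - B n - B (n + 1) with hδ
  set E : ℕ → ℝ := fun n => X n * (X n - y * u n) / B n + y * u n ^ 2 with hE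
  set A : ℝ := α ^ 2 with hA
  set K : ℝ := (y * (1 + A) + 2 * A) / √y + 2 * A ^ 2 / y with hK
  have hA0 : 0 ≤ A := sq_nonneg _
  have hK0 : 0 ≤ K := by positivity
  have hB2 : ∀ n, B n ^ 2 = ((n : ℝ) + 1) * (n + 1 + α) := fun n => by
    have hn : (0 : ℝ) ≤ n := Nat.cast_nonneg n
    exact Real.sq_sqrt (mul_nonneg (by linarith) (by linarith))
  have hBpos : ∀ n, 0 < B n := fun n => by
    have hn : (0 : ℝ) ≤ n := Nat.cast_nonneg n
    exact Real.sqrt_pos.2 (mul_pos (by linarith) (by linarith))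
  have hBlow : ∀ n : ℕ, 1 ≤ n → ((n : ℝ) + 1) / 2 ≤ B n := fun n hn => by
    have hn : (1 : ℝ) ≤ n := by exact_mod_cast hn
    apply Real.le_sqrt_of_sq_le
    nlinarith
  have hr0 : ∀ n : ℕ, 0 ≤ (n : ℝ) + 1 + α / 2 - B n := fun n => by
    have hn : (0 : ℝ) ≤ n := Nat.cast_nonneg n
    nlinarith [hB2 n, hBpos n, sq_nonneg α]
  have hr : ∀ n : ℕ, (n : ℝ) + 1 + α / 2 - B n ≤ A / 4 / B n := fun n => by
    rw [le_div_iff₀ (hBpos n)]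
    nlinarith [hB2 n, hBpos n, sq_nonneg α, hr0 n]
  have hBB : ∀ n, B n ≤ B (n + 1) := fun n => by
    have hn : (0 : ℝ) ≤ n := Nat.cast_nonneg n
    apply Real.sqrt_le_sqrt
    push_cast
    nlinarith
  have hstep : ∀ n, E (n + 1) = (X n - y * u n + δ n * u n) * (X n + δ n * u n) / B (n + 1)
      + y * u n ^ 2 := fun n => by
    have hrec := lagPhi_rec hα n y
    have hBn : B (n + 1) = √(((n : ℝ) + 2) * (n + 2 + α)) := by
      simp only [hB]; push_cast; ring_nf
    rw [← hBn] at hrec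
    change B (n + 1) * u (n + 1) = (2 * n + 3 + α - y) * u n - B n * lagPhi α n y at hrec
    have hX' : X (n + 1) = X n - (y - δ n) * u n := by
      change B (n + 1) * (u (n + 1) - u n) = B n * (u n - lagPhi α n y) - (y - δ n) * u n
      rw [hδ]
      linear_combination hrec
    have hu' : u (n + 1) = u n + X (n + 1) / B (n + 1) := by
      have := (hBpos (n + 1)).ne'
      change u (n + 1) = u n + B (n + 1) * (u (n + 1) - u n) / B (n + 1)
      field_simp; ring
    have hb := (hBpos (n + 1)).ne'
    change X (n + 1) * (X (n + 1) - y * u (n + 1)) / B (n + 1) + y * u (n + 1) ^ 2 = _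
    rw [hu', hX']
    field_simp
    ring
  obtain ⟨n0, hn0⟩ := exists_nat_ge (2 * y + 1)
  have hn01 : 1 ≤ n0 := by
    have : (1 : ℝ) ≤ n0 := by linarith
    exact_mod_cast this
  have main : ∀ n, n0 ≤ n → E (n + 1) ≤ (1 + K / (B n * √(B n))) * E n ∧ y * u n ^ 2 ≤ 2 * E n := by
    intro n hn
    have hnn : (n0 : ℝ) ≤ n := by exact_mod_cast hn
    have hb := hBlow n (by omega)
    have h1 : 1 ≤ B n := by linarith
    rw [hstep]
    have hr' : A / 4 / B n ≤ A / 4 := div_le_self (by positivity) h1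
    have hrr : A / 4 / B (n + 1) ≤ A / 4 / B n :=
      div_le_div_of_nonneg_left (by positivity) (hBpos n) (hBB n)
    have e1 := hr0 n
    have e2 := hr0 (n + 1)
    have e3 := hr n
    have e4 := hr (n + 1)
    push_cast at e2 e4
    refine energy_step y A (B n) (B (n + 1)) (X n) (u n) (δ n) hy h1 (by linarith) (hBB n)
      (by linarith) hA0 ?_ ?_
    · simp only [hδ]; linarith
    · simp only [hδ]
      have : A / 4 / B n = A / B n / 4 := by ring
      have : 0 ≤ A / B n := div_nonneg hA0 (hBpos n).le
      linarith
  have hsum : Summable fun n => K / (B n * √(B n)) := by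
    have h1 : Summable fun n : ℕ => (4 * K) * (1 / (n : ℝ) ^ (3 / 2 : ℝ)) :=
      (Real.summable_one_div_nat_rpow.2 (by norm_num)).mul_left _
    refine Summable.of_norm_bounded_eventually_nat h1 ?_
    filter_upwards [Filter.eventually_ge_atTop 1] with n hn
    have hb := hBlow n hn
    have hn1 : (1 : ℝ) ≤ n := by exact_mod_cast hn
    have hb0 := hBpos n
    rw [Real.norm_of_nonneg (by positivity)]
    have h32 : (n : ℝ) ^ (3 / 2 : ℝ) = n * √n := by
      rw [show (3 / 2 : ℝ) = 1 + 1 / 2 by norm_num, Real.rpow_add (by linarith), Real.rpow_one,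
        Real.sqrt_eq_rpow]
    rw [h32, mul_one_div, div_le_div_iff₀ (by positivity) (by positivity)]
    have h2 : √(n : ℝ) ≤ 2 * √(B n) := by
      rw [Real.sqrt_le_left (by positivity), mul_pow, Real.sq_sqrt hb0.le]
      linarith
    have h3 : (n : ℝ) ≤ 2 * B n := by linarith
    calc K * (n * √n) ≤ K * (2 * B n * (2 * √(B n))) := by gcongr
      _ = _ := by ring
  have hbd := growth_bdd E (fun n => K / (B n * √(B n))) n0
    (fun n hn => by have := (main n hn).2; have : 0 ≤ y * u n ^ 2 := by positivity
                    linarith)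
    (fun n => by have := hBpos n; positivity) hsum (fun n hn => (main n hn).1)
  set Q := E n0 * Real.exp (∑' n, K / (B n * √(B n))) with hQ
  have hev : ∀ n, n0 + 1 ≤ n → lagPhi α n y ^ 2 ≤ 2 * Q / y := by
    intro n hn
    obtain ⟨m, rfl⟩ : ∃ m, n = m + 1 := ⟨n - 1, by omega⟩
    have hm : n0 ≤ m := by omega
    rw [le_div_iff₀ hy]
    have := (main m hm).2
    have := hbd m hm
    have : y * lagPhi α (m + 1) y ^ 2 = y * u m ^ 2 := rfl
    linarith
  have : BddAbove (Set.range fun n => lagPhi α n y ^ 2) := by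
    apply Filter.IsBoundedUnder.bddAbove_range
    exact Filter.isBoundedUnder_of_eventually_le (a := 2 * Q / y)
      (Filter.eventually_atTop.2 ⟨n0 + 1, hev⟩)
  obtain ⟨M, hM⟩ := this
  have hM' : ∀ n, lagPhi α n y ^ 2 ≤ M := fun n => hM ⟨n, rfl⟩
  exact ⟨M, (sq_nonneg _).trans (hM' 0), hM'⟩

noncomputable def lagW (α x : ℝ) : ℝ := x ^ α * Real.exp (-x)

lemma mom_aux {α : ℝ} (hα : -1 < α) (k : ℕ) :
    IntegrableOn (fun x : ℝ => x ^ k * lagW α x) (Set.Ioi 0) ∧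
    ∫ x in Set.Ioi (0 : ℝ), x ^ k * lagW α x = Real.Gamma (k + α + 1) := by
  have hk : (0 : ℝ) < k + α + 1 := by
    have : (0 : ℝ) ≤ k := Nat.cast_nonneg k
    linarith
  have hcongr : ∀ x ∈ Set.Ioi (0 : ℝ),
      Real.exp (-x) * x ^ ((k + α + 1 : ℝ) - 1) = x ^ k * lagW α x := by
    intro x hx
    rw [add_sub_cancel_right, Real.rpow_add hx, Real.rpow_natCast, lagW]
    ring
  constructor
  · exact (Real.GammaIntegral_convergent hk).congr_fun hcongr measurableSet_Ioi
  · rw [Real.Gamma_eq_integral hk]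
    exact (setIntegral_congr_fun measurableSet_Ioi hcongr).symm

lemma gamma_poch {s : ℝ} (hs : 0 < s) (k : ℕ) :
    Real.Gamma (s + k) = (ascPochhammer ℝ k).eval s * Real.Gamma s := by
  induction k with
  | zero => simp
  | succ k ih =>
    rw [ascPochhammer_succ_eval]
    have h : s + k ≠ 0 := by positivity
    rw [show s + ((k + 1 : ℕ) : ℝ) = (s + k) + 1 by push_cast; ring, Real.Gamma_add_one h, ih]
    ring

lemma alt_sum (a : ℝ) (k n : ℕ) (hk : k ≤ n) :
    ∑ j ∈ Finset.range (n + 1), (-1 : ℝ) ^ j * (n.choose j) * (ascPochhammer ℝ k).eval (a + j)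
      = if k = n then (-1 : ℝ) ^ n * (Nat.factorial n) else 0 := by
  have h1 := fwdDiff_iter_eq_sum_shift (1 : ℝ) (ascPochhammer ℝ k).eval n a
  have h2 : ∑ j ∈ Finset.range (n + 1),
      (-1 : ℝ) ^ j * (n.choose j) * (ascPochhammer ℝ k).eval (a + j)
      = (-1 : ℝ) ^ n * ∑ j ∈ Finset.range (n + 1),
        ((-1 : ℤ) ^ (n - j) * n.choose j) • (ascPochhammer ℝ k).eval (a + j • (1 : ℝ)) := by
    rw [Finset.mul_sum]
    refine Finset.sum_congr rfl fun j hj => ?_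
    have hj' : j ≤ n := by simpa [Nat.lt_succ_iff] using hj
    have : (-1 : ℝ) ^ j = (-1 : ℝ) ^ n * (-1 : ℝ) ^ (n - j) := by
      rw [← pow_add]
      have : n + (n - j) = j + 2 * (n - j) := by omega
      rw [this, pow_add, pow_mul]; simp
    rw [zsmul_eq_mul, this]
    push_cast
    rw [nsmul_eq_mul, mul_one]
    ring
  rw [h2, ← h1]
  have hdeg : (ascPochhammer ℝ k).natDegree = k := ascPochhammer_natDegree ℝ k
  split_ifs with h
  · subst h
    have := Polynomial.fwdDiff_iter_degree_eq_factorial (ascPochhammer ℝ k)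
    rw [hdeg] at this
    rw [this, (monic_ascPochhammer ℝ k).leadingCoeff]
    simp
  · rw [Polynomial.fwdDiff_iter_eq_zero_of_degree_lt (by omega)]
    simp

lemma integrable_mono {α : ℝ} (hα : -1 < α) (c : ℝ) (k : ℕ) :
    IntegrableOn (fun x : ℝ => c * (x ^ k * lagW α x)) (Set.Ioi 0) :=
  (mom_aux hα k).1.const_mul c

lemma mom_P {α : ℝ} (hα : -1 < α) (k n : ℕ) :
    IntegrableOn (fun x : ℝ => x ^ k * lagP α n x * lagW α x) (Set.Ioi 0) ∧
    ∫ x in Set.Ioi (0 : ℝ), x ^ k * lagP α n x * lagW α x =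
      ∑ j ∈ Finset.range (n + 1),
        (-1 : ℝ) ^ j * (n.choose j) * (ascPochhammer ℝ k).eval ((α + 1) + j) := by
  have hfun : (fun x : ℝ => x ^ k * lagP α n x * lagW α x) = fun x =>
      ∑ j ∈ Finset.range (n + 1),
        (-1 : ℝ) ^ j * (n.choose j) / Real.Gamma (j + α + 1) * (x ^ (j + k) * lagW α x) := by
    funext x
    rw [lagP, Finset.mul_sum, Finset.sum_mul]
    refine Finset.sum_congr rfl fun j _ => by ring
  rw [hfun]
  constructor
  · exact integrable_finsetSum _ fun j _ => integrable_mono hα _ _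
  · rw [integral_finsetSum _ fun j _ => integrable_mono hα _ _]
    refine Finset.sum_congr rfl fun j _ => ?_
    rw [integral_const_mul, (mom_aux hα (j + k)).2]
    have hj : (0 : ℝ) < α + 1 + j := by
      have : (0 : ℝ) ≤ j := Nat.cast_nonneg j
      linarith
    have hg := gamma_poch hj k
    rw [show ((j + k : ℕ) : ℝ) + α + 1 = α + 1 + j + k by push_cast; ring, hg,
      show (j : ℝ) + α + 1 = α + 1 + j by ring]
    have := (Real.Gamma_pos_of_pos hj).ne'
    field_simp

lemma orth_P {α : ℝ} (hα : -1 < α) (m n : ℕ) (hmn : m ≤ n) :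
    IntegrableOn (fun x : ℝ => lagP α m x * lagP α n x * lagW α x) (Set.Ioi 0) ∧
    ∫ x in Set.Ioi (0 : ℝ), lagP α m x * lagP α n x * lagW α x =
      if m = n then (lagH α n)⁻¹ else 0 := by
  have hfun : (fun x : ℝ => lagP α m x * lagP α n x * lagW α x) = fun x =>
      ∑ k ∈ Finset.range (m + 1),
        (-1 : ℝ) ^ k * (m.choose k) / Real.Gamma (k + α + 1)
          * (x ^ k * lagP α n x * lagW α x) := by
    funext x
    nth_rewrite 1 [lagP]
    rw [Finset.sum_mul, Finset.sum_mul]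
    refine Finset.sum_congr rfl fun j _ => by ring
  rw [hfun]
  constructor
  · exact integrable_finsetSum _ fun j _ => (mom_P hα j n).1.const_mul _
  · rw [integral_finsetSum _ fun j _ => (mom_P hα j n).1.const_mul _]
    have : ∀ k ∈ Finset.range (m + 1),
        ∫ x in Set.Ioi (0 : ℝ), (-1 : ℝ) ^ k * (m.choose k) / Real.Gamma (k + α + 1)
          * (x ^ k * lagP α n x * lagW α x) =
        if k = n then (lagH α n)⁻¹ else 0 := by
      intro k hk
      have hk' : k ≤ m := by simpa [Nat.lt_succ_iff] using hk
      rw [integral_const_mul, (mom_P hα k n).2, alt_sum _ _ _ (hk'.trans hmn)]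
      split_ifs with h
      · subst h
        have : m = k := le_antisymm hmn hk'
        subst this
        rw [lagH, Nat.choose_self, inv_div]
        have : (-1 : ℝ) ^ m * (-1 : ℝ) ^ m = 1 := by rw [← mul_pow]; simp
        push_cast
        linear_combination (Nat.factorial m : ℝ) / Real.Gamma (m + α + 1) * this
      · simp
    rw [Finset.sum_congr rfl this, Finset.sum_ite_eq']
    simp only [Finset.mem_range]
    have : n < m + 1 ↔ m = n := by omega
    simp only [this]

lemma orth_phi_le {α : ℝ} (hα : -1 < α) (m n : ℕ) (hmn : m ≤ n) :
    IntegrableOn (fun x : ℝ => lagPhi α m x * lagPhi α n x * lagW α x) (Set.Ioi 0) ∧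
    ∫ x in Set.Ioi (0 : ℝ), lagPhi α m x * lagPhi α n x * lagW α x = if m = n then 1 else 0 := by
  have hfun : (fun x : ℝ => lagPhi α m x * lagPhi α n x * lagW α x) = fun x =>
      (√(lagH α m) * √(lagH α n)) * (lagP α m x * lagP α n x * lagW α x) := by
    funext x
    rw [lagPhi_eq hα, lagPhi_eq hα]; ring
  rw [hfun]
  refine ⟨(orth_P hα m n hmn).1.const_mul _, ?_⟩
  rw [integral_const_mul, (orth_P hα m n hmn).2]
  split_ifs with h
  · subst h
    rw [Real.mul_self_sqrt (lagH_pos hα m).le, mul_inv_cancel₀ (lagH_pos hα m).ne']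
  · simp

noncomputable def lagE (α : ℝ) (n : ℕ) (x : ℝ) : ℝ := √(lagW α x) * lagPhi α n x

lemma lagW_nonneg {α x : ℝ} (hx : 0 < x) : 0 ≤ lagW α x := by
  unfold lagW; positivity

lemma lagE_mul {α x : ℝ} (hx : 0 < x) (m n : ℕ) :
    lagE α m x * lagE α n x = lagPhi α m x * lagPhi α n x * lagW α x := by
  unfold lagE
  have := Real.mul_self_sqrt (lagW_nonneg (α := α) hx)
  linear_combination lagPhi α m x * lagPhi α n x * this

lemma orth_E {α : ℝ} (hα : -1 < α) (m n : ℕ) :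
    Integrable (fun x : ℝ => lagE α m x * lagE α n x) (volume.restrict (Set.Ioi 0)) ∧
    ∫ x in Set.Ioi (0 : ℝ), lagE α m x * lagE α n x = if m = n then 1 else 0 := by
  wlog hmn : m ≤ n generalizing m n
  · have := this n m (by omega)
    simp only [mul_comm (lagE α m _)]
    simpa only [eq_comm] using this
  have h := orth_phi_le hα m n hmn
  constructor
  · exact h.1.congr_fun (fun x hx => (lagE_mul hx m n).symm) measurableSet_Ioi
  · rw [← h.2]
    exact setIntegral_congr_fun measurableSet_Ioi (fun x hx => lagE_mul hx m n)

lemma lagE_meas (α : ℝ) (n : ℕ) : Measurable (lagE α n) := by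
  unfold lagE lagW lagPhi genLaguerre
  fun_prop

section bessel
variable {T V : Type*} [MeasurableSpace T] {ν : Measure T}
  [NormedAddCommGroup V] [InnerProductSpace ℝ V] [CompleteSpace V]

lemma integrable_smul_of_sq {e : T → ℝ} {Φ : T → V} (he : AEStronglyMeasurable e ν)
    (hΦ : AEStronglyMeasurable Φ ν) (he2 : Integrable (fun x => e x * e x) ν)
    (hΦ2 : Integrable (fun x => ‖Φ x‖ ^ 2) ν) :
    Integrable (fun x => e x • Φ x) ν ∧
    ∫ x, ‖e x • Φ x‖ ∂ν ≤ (∫ x, e x * e x ∂ν) + ∫ x, ‖Φ x‖ ^ 2 ∂ν := by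
  have hb : ∀ x, ‖e x • Φ x‖ ≤ e x * e x + ‖Φ x‖ ^ 2 := by
    intro x
    rw [norm_smul, Real.norm_eq_abs, ← abs_mul_abs_self (e x)]
    nlinarith [sq_nonneg (|e x| - ‖Φ x‖), abs_nonneg (e x), norm_nonneg (Φ x),
      mul_nonneg (abs_nonneg (e x)) (norm_nonneg (Φ x))]
  have hi : Integrable (fun x => e x • Φ x) ν :=
    (he2.add hΦ2).mono' (he.smul hΦ) (Filter.Eventually.of_forall hb)
  refine ⟨hi, ?_⟩
  rw [← integral_add he2 hΦ2]
  exact integral_mono hi.norm (he2.add hΦ2) hb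

lemma bessel_ineq {e : ℕ → T → ℝ} {Φ : T → V} (he : ∀ n, AEStronglyMeasurable (e n) ν)
    (hΦ : AEStronglyMeasurable Φ ν)
    (heI : ∀ m n, Integrable (fun x => e m x * e n x) ν)
    (heO : ∀ m n, ∫ x, e m x * e n x ∂ν = if m = n then 1 else 0)
    (hΦ2 : Integrable (fun x => ‖Φ x‖ ^ 2) ν) (N : ℕ) :
    ∑ n ∈ Finset.range N, ‖∫ x, e n x • Φ x ∂ν‖ ^ 2 ≤ ∫ x, ‖Φ x‖ ^ 2 ∂ν := by
  set a : ℕ → V := fun n => ∫ x, e n x • Φ x ∂ν with ha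
  have hI : ∀ n, Integrable (fun x => e n x • Φ x) ν := fun n =>
    (integrable_smul_of_sq (he n) hΦ (heI n n) hΦ2).1
  have hexp : ∀ x, ‖Φ x - ∑ n ∈ Finset.range N, e n x • a n‖ ^ 2 =
      ‖Φ x‖ ^ 2 - 2 * ∑ n ∈ Finset.range N, inner ℝ (a n) (e n x • Φ x)
      + ∑ m ∈ Finset.range N, ∑ n ∈ Finset.range N, (e m x * e n x) * inner ℝ (a m) (a n) := by
    intro x
    rw [norm_sub_sq_real, ← real_inner_self_eq_norm_sq (∑ n ∈ Finset.range N, e n x • a n),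
      inner_sum, sum_inner]
    congr 1
    · congr 2
      refine Finset.sum_congr rfl fun n _ => ?_
      rw [inner_smul_right, inner_smul_right, real_inner_comm]
    · refine Finset.sum_congr rfl fun m _ => ?_
      rw [inner_sum]
      refine Finset.sum_congr rfl fun n _ => ?_
      rw [inner_smul_left, inner_smul_right]
      simp
      ring
  have h0 : 0 ≤ ∫ x, ‖Φ x - ∑ n ∈ Finset.range N, e n x • a n‖ ^ 2 ∂ν :=
    integral_nonneg fun x => sq_nonneg _
  simp only [hexp] at h0
  have i1 : Integrable (fun x => ∑ n ∈ Finset.range N, inner ℝ (a n) (e n x • Φ x)) ν :=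
    integrable_finsetSum _ fun n _ => (hI n).const_inner (a n)
  have i2 : Integrable (fun x => ∑ m ∈ Finset.range N, ∑ n ∈ Finset.range N,
      (e m x * e n x) * inner ℝ (a m) (a n)) ν :=
    integrable_finsetSum _ fun m _ => integrable_finsetSum _ fun n _ => (heI m n).mul_const _
  have i3 : Integrable (fun x => ‖Φ x‖ ^ 2
      - 2 * ∑ n ∈ Finset.range N, inner ℝ (a n) (e n x • Φ x)) ν := hΦ2.sub (i1.const_mul 2)
  rw [integral_add i3 i2, integral_sub hΦ2 (i1.const_mul 2),
    integral_const_mul, integral_finsetSum _ fun n _ => (hI n).const_inner (a n),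
    integral_finsetSum _ fun m _ => integrable_finsetSum _ fun n _ => (heI m n).mul_const _] at h0
  have e1 : ∀ n, ∫ x, inner ℝ (a n) (e n x • Φ x) ∂ν = ‖a n‖ ^ 2 := fun n => by
    rw [integral_inner (hI n), ← real_inner_self_eq_norm_sq]
  have e2 : ∀ m ∈ Finset.range N, ∫ x, ∑ n ∈ Finset.range N, (e m x * e n x) * inner ℝ (a m) (a n) ∂ν
      = ‖a m‖ ^ 2 := fun m hm => by
    rw [integral_finsetSum _ fun n _ => (heI m n).mul_const _]
    simp only [integral_mul_const, heO]
    simp [Finset.mem_range.1 hm]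
  rw [Finset.sum_congr rfl e2] at h0
  simp only [e1] at h0
  linarith

end bessel

lemma unit_facts {I : ℍ[ℝ]} (hI : I ^ 2 = -1) :
    I.re = 0 ∧ I.imI ^ 2 + I.imJ ^ 2 + I.imK ^ 2 = 1 := by
  have hn : ‖I‖ ^ 2 = 1 := by
    rw [← norm_pow, hI, norm_neg, norm_one]
  have hs : Quaternion.normSq I = 1 := by
    rw [Quaternion.normSq_eq_norm_mul_self, ← sq, hn]
  rw [Quaternion.normSq_def'] at hs
  have hre := congrArg (fun q : ℍ[ℝ] => q.re) hI
  simp [sq, Quaternion.re_mul] at hre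
  have : I.re ^ 2 = 0 := by nlinarith
  have h0 : I.re = 0 := by simpa using this
  refine ⟨h0, ?_⟩
  rw [h0] at hs
  linarith

noncomputable def eps (I : ℍ[ℝ]) (θ : ℝ) : ℍ[ℝ] := (Real.cos θ : ℍ[ℝ]) + Real.sin θ • I

lemma eps_add {I : ℍ[ℝ]} (hI : I ^ 2 = -1) (a b : ℝ) : eps I a * eps I b = eps I (a + b) := by
  obtain ⟨h0, h1⟩ := unit_facts hI
  unfold eps
  rw [Real.cos_add, Real.sin_add]
  ext
  · simp [h0]; linear_combination (-(Real.sin a * Real.sin b)) * h1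
  · simp [h0]; ring
  · simp [h0]; ring
  · simp [h0]; ring

lemma eps_pow {I : ℍ[ℝ]} (hI : I ^ 2 = -1) (a : ℝ) (n : ℕ) : eps I a ^ n = eps I (n * a) := by
  induction n with
  | zero => simp [eps]
  | succ n ih => rw [pow_succ, ih, eps_add hI]; congr 1; push_cast; ring

lemma eps_inner {I : ℍ[ℝ]} (hI : I ^ 2 = -1) (a b : ℝ) (v w : ℍ[ℝ]) :
    inner ℝ (eps I a * v) (eps I b * w)
      = Real.cos (a - b) * inner ℝ v w + Real.sin (a - b) * inner ℝ (I * v) w := by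
  obtain ⟨h0, h1⟩ := unit_facts hI
  unfold eps
  rw [Real.cos_sub, Real.sin_sub]
  simp only [Quaternion.inner_def]
  simp [h0]
  linear_combination (Real.sin a * Real.sin b *
    (v.re * w.re + v.imI * w.imI + v.imJ * w.imJ + v.imK * w.imK)) * h1

lemma int_cos (c : ℤ) : ∫ θ in (-π)..π, Real.cos (c * θ) = if c = 0 then 2 * π else 0 := by
  split_ifs with h
  · subst h; simp; ring
  · have hc : (c : ℝ) ≠ 0 := by exact_mod_cast h
    rw [intervalIntegral.integral_comp_mul_left (fun θ => Real.cos θ) hc, integral_cos]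
    rw [mul_neg, Real.sin_neg, Real.sin_int_mul_pi]
    simp

lemma int_sin (c : ℤ) : ∫ θ in (-π)..π, Real.sin (c * θ) = 0 := by
  by_cases h : c = 0
  · subst h; simp
  · have hc : (c : ℝ) ≠ 0 := by exact_mod_cast h
    rw [intervalIntegral.integral_comp_mul_left (fun θ => Real.sin θ) hc, integral_sin]
    rw [mul_neg, Real.cos_neg]
    simp

lemma circle_int {I : ℍ[ℝ]} (hI : I ^ 2 = -1) (N : ℕ) (v : ℕ → ℍ[ℝ]) :
    ∫ θ in (-π)..π, ‖∑ n ∈ Finset.range N, eps I (n * θ) * v n‖ ^ 2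
      = 2 * π * ∑ n ∈ Finset.range N, ‖v n‖ ^ 2 := by
  have hexp : ∀ θ : ℝ, ‖∑ n ∈ Finset.range N, eps I (n * θ) * v n‖ ^ 2 =
      ∑ m ∈ Finset.range N, ∑ n ∈ Finset.range N,
        (Real.cos (((m : ℤ) - (n : ℤ) : ℤ) * θ) * inner ℝ (v m) (v n)
        + Real.sin (((m : ℤ) - (n : ℤ) : ℤ) * θ) * inner ℝ (I * v m) (v n)) := by
    intro θ
    rw [← real_inner_self_eq_norm_sq, sum_inner]
    refine Finset.sum_congr rfl fun m _ => ?_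
    rw [inner_sum]
    refine Finset.sum_congr rfl fun n _ => ?_
    rw [eps_inner hI, ← sub_mul]
    push_cast
    rfl
  simp only [hexp]
  rw [intervalIntegral.integral_finsetSum
    (fun m _ => Continuous.intervalIntegrable (by fun_prop) _ _), Finset.mul_sum]
  refine Finset.sum_congr rfl fun m hm => ?_
  rw [intervalIntegral.integral_finsetSum
    (fun m _ => Continuous.intervalIntegrable (by fun_prop) _ _)]
  have : ∀ n ∈ Finset.range N, ∫ θ in (-π)..π,
      (Real.cos (((m : ℤ) - (n : ℤ) : ℤ) * θ) * inner ℝ (v m) (v n)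
        + Real.sin (((m : ℤ) - (n : ℤ) : ℤ) * θ) * inner ℝ (I * v m) (v n))
      = if m = n then 2 * π * ‖v m‖ ^ 2 else 0 := by
    intro n _
    rw [intervalIntegral.integral_add (Continuous.intervalIntegrable (by fun_prop) _ _)
      (Continuous.intervalIntegrable (by fun_prop) _ _), intervalIntegral.integral_mul_const,
      intervalIntegral.integral_mul_const, int_cos, int_sin]
    by_cases h : m = n
    · subst h; simp
    · have : ¬ ((m : ℤ) - n = 0) := by omega
      simp [h, this]
  rw [Finset.sum_congr rfl this, Finset.sum_ite_eq, if_pos hm]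

lemma circle_lint {I : ℍ[ℝ]} (hI : I ^ 2 = -1) (N : ℕ) (v : ℕ → ℍ[ℝ]) (r : ℝ) (hr0 : 0 ≤ r)
    (hr1 : r ≤ 1) :
    ∫⁻ θ in Set.Ioo (-π) π,
      ENNReal.ofReal (‖∑ n ∈ Finset.range N, (r • eps I θ) ^ n * v n‖ ^ 2)
      ≤ ENNReal.ofReal (2 * π * ∑ n ∈ Finset.range N, ‖v n‖ ^ 2) := by
  have hfun : ∀ θ, ∑ n ∈ Finset.range N, (r • eps I θ) ^ n * v n
      = ∑ n ∈ Finset.range N, eps I (n * θ) * (r ^ n • v n) := by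
    intro θ
    refine Finset.sum_congr rfl fun n _ => ?_
    rw [smul_pow, eps_pow hI, smul_mul_assoc, mul_smul_comm]
  simp only [hfun]
  have hcont : Continuous fun θ : ℝ =>
      ‖∑ n ∈ Finset.range N, eps I (n * θ) * (r ^ n • v n)‖ ^ 2 := by
    have : Continuous (fun x : ℝ => (x : ℍ[ℝ])) := Quaternion.continuous_coe
    unfold eps
    fun_prop
  rw [← ofReal_integral_eq_lintegral_ofReal
    ((hcont.integrableOn_Icc (a := -π) (b := π)).mono_set Set.Ioo_subset_Icc_self)
    (Filter.Eventually.of_forall fun _ => sq_nonneg _),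
    ← integral_Ioc_eq_integral_Ioo,
    ← intervalIntegral.integral_of_le (by linarith [Real.pi_pos]), circle_int hI]
  apply ENNReal.ofReal_le_ofReal
  have := Real.pi_pos
  gcongr with n _
  rw [norm_smul, norm_pow, Real.norm_of_nonneg hr0]
  exact mul_le_of_le_one_left (norm_nonneg _) (pow_le_one₀ hr0 hr1)

lemma beta_fin {β η : ℝ} (hβ : 0 < β) (hη : 0 < η) :
    ∫⁻ r in Set.Ioo (0 : ℝ) 1, ENNReal.ofReal (r * weightBeta β η (r ^ 2)) < ⊤ := by
  have hbp := ProbabilityTheory.beta_pos (mul_pos two_pos hβ) hη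
  have hle : ∀ r ∈ Set.Ioo (0 : ℝ) 1, ENNReal.ofReal (r * weightBeta β η (r ^ 2)) ≤
      ENNReal.ofReal (2 ^ |η - 1| * ProbabilityTheory.beta (2 * β) η)
        * ProbabilityTheory.betaPDF (2 * β) η r := by
    rintro r ⟨h0, h1⟩
    rw [ProbabilityTheory.betaPDF_of_pos_lt_one h0 h1, ← ENNReal.ofReal_mul (by positivity)]
    apply ENNReal.ofReal_le_ofReal
    unfold weightBeta
    have e1 : r * (r ^ 2) ^ (β - 1) = r ^ (2 * β - 1) := by
      rw [← Real.rpow_natCast r 2, ← Real.rpow_mul h0.le]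
      nth_rewrite 1 [← Real.rpow_one r]
      rw [← Real.rpow_add h0]
      congr 1; push_cast; ring
    have e2 : (1 - r ^ 2) ^ (η - 1) = (1 - r) ^ (η - 1) * (1 + r) ^ (η - 1) := by
      rw [← Real.mul_rpow (by linarith) (by linarith)]
      congr 1; ring
    have e3 : (1 + r) ^ (η - 1) ≤ 2 ^ |η - 1| := by
      calc (1 + r) ^ (η - 1) ≤ (1 + r) ^ |η - 1| :=
            Real.rpow_le_rpow_of_exponent_le (by linarith) (le_abs_self _)
        _ ≤ 2 ^ |η - 1| := Real.rpow_le_rpow (by linarith) (by linarith) (abs_nonneg _)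
    have h1r : 0 ≤ (1 - r) ^ (η - 1) := Real.rpow_nonneg (by linarith) _
    rw [e2, ← mul_assoc, e1]
    calc r ^ (2 * β - 1) * ((1 - r) ^ (η - 1) * (1 + r) ^ (η - 1))
        ≤ r ^ (2 * β - 1) * ((1 - r) ^ (η - 1) * 2 ^ |η - 1|) := by gcongr
      _ = _ := by field_simp
  calc _ ≤ ∫⁻ r in Set.Ioo (0 : ℝ) 1,
        ENNReal.ofReal (2 ^ |η - 1| * ProbabilityTheory.beta (2 * β) η)
        * ProbabilityTheory.betaPDF (2 * β) η r := setLIntegral_mono' measurableSet_Ioo hle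
    _ ≤ ∫⁻ r, ENNReal.ofReal (2 ^ |η - 1| * ProbabilityTheory.beta (2 * β) η)
        * ProbabilityTheory.betaPDF (2 * β) η r := setLIntegral_le_lintegral _ _
    _ = ENNReal.ofReal (2 ^ |η - 1| * ProbabilityTheory.beta (2 * β) η) * 1 := by
        rw [lintegral_const_mul' _ _ ENNReal.ofReal_ne_top,
          ProbabilityTheory.lintegral_betaPDF_eq_one (mul_pos two_pos hβ) hη]
    _ < ⊤ := by rw [mul_one]; exact ENNReal.ofReal_lt_top

lemma weightBeta_meas (β η : ℝ) : Measurable (weightBeta β η) := by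
  unfold weightBeta; fun_prop

lemma disc_meas : MeasurableSet {p : ℝ × ℝ | p.1 ^ 2 + p.2 ^ 2 < 1} :=
  measurableSet_lt (by fun_prop) measurable_const

lemma disc_lint {I : ℍ[ℝ]} (hI : I ^ 2 = -1) (β η : ℝ) (N : ℕ) (v : ℕ → ℍ[ℝ]) :
    ∫⁻ p in {p : ℝ × ℝ | p.1 ^ 2 + p.2 ^ 2 < 1},
      ENNReal.ofReal (‖∑ n ∈ Finset.range N, ((p.1 : ℍ[ℝ]) + p.2 • I) ^ n * v n‖ ^ 2 *
          weightBeta β η (p.1 ^ 2 + p.2 ^ 2)) ≤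
    (∫⁻ r in Set.Ioo (0 : ℝ) 1, ENNReal.ofReal (r * weightBeta β η (r ^ 2))) *
      ENNReal.ofReal (2 * π * ∑ n ∈ Finset.range N, ‖v n‖ ^ 2) := by
  rw [← lintegral_indicator disc_meas, ← lintegral_comp_polarCoord_symm, polarCoord_target]
  set G : ℝ × ℝ → ENNReal := fun p =>
    (Set.Ioo (0 : ℝ) 1).indicator (fun r => ENNReal.ofReal (r * weightBeta β η (r ^ 2))) p.1 *
      ENNReal.ofReal (‖∑ n ∈ Finset.range N, (p.1 • eps I p.2) ^ n * v n‖ ^ 2) with hG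
  have hle : ∀ p ∈ Set.Ioi (0 : ℝ) ×ˢ Set.Ioo (-π) π,
      ENNReal.ofReal p.1 • ({p : ℝ × ℝ | p.1 ^ 2 + p.2 ^ 2 < 1}.indicator (fun p =>
        ENNReal.ofReal (‖∑ n ∈ Finset.range N, ((p.1 : ℍ[ℝ]) + p.2 • I) ^ n * v n‖ ^ 2 *
          weightBeta β η (p.1 ^ 2 + p.2 ^ 2))) (polarCoord.symm p)) ≤ G p := by
    rintro ⟨r, θ⟩ ⟨hr, _⟩
    have hr : 0 < r := hr
    have hsq : (r * Real.cos θ) ^ 2 + (r * Real.sin θ) ^ 2 = r ^ 2 := by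
      linear_combination r ^ 2 * Real.sin_sq_add_cos_sq θ
    have hq : ((r * Real.cos θ : ℝ) : ℍ[ℝ]) + (r * Real.sin θ) • I = r • eps I θ := by
      unfold eps
      rw [smul_add, smul_smul]
      congr 1
      ext <;> simp
    simp only [hG, polarCoord_symm_apply, Set.indicator, Set.mem_ofPred_eq, hsq, hq]
    by_cases h : r < 1
    · have h2 : r ^ 2 < 1 := by nlinarith
      rw [if_pos h2, if_pos ⟨hr, h⟩, smul_eq_mul, ← ENNReal.ofReal_mul hr.le]
      have hw : 0 ≤ weightBeta β η (r ^ 2) :=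
        mul_nonneg (Real.rpow_nonneg (by positivity) _) (Real.rpow_nonneg (by linarith) _)
      rw [← ENNReal.ofReal_mul (by positivity)]
      apply le_of_eq; congr 1; ring
    · have h2 : ¬ r ^ 2 < 1 := by nlinarith
      rw [if_neg h2]; simp
  have hGm : Measurable G := by
    have h1 : Measurable fun p : ℝ × ℝ => (Set.Ioo (0 : ℝ) 1).indicator
        (fun r => ENNReal.ofReal (r * weightBeta β η (r ^ 2))) p.1 := by
      have : Measurable ((Set.Ioo (0 : ℝ) 1).indicator
        (fun r => ENNReal.ofReal (r * weightBeta β η (r ^ 2)))) := by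
        apply Measurable.indicator _ measurableSet_Ioo
        have := weightBeta_meas β η
        fun_prop
      exact this.comp measurable_fst
    have h2 : Continuous fun p : ℝ × ℝ =>
        ‖∑ n ∈ Finset.range N, (p.1 • eps I p.2) ^ n * v n‖ ^ 2 := by
      have : Continuous (fun x : ℝ => (x : ℍ[ℝ])) := Quaternion.continuous_coe
      unfold eps
      fun_prop
    exact h1.mul h2.measurable.ennreal_ofReal
  calc _ ≤ ∫⁻ p in Set.Ioi (0 : ℝ) ×ˢ Set.Ioo (-π) π, G p :=
        setLIntegral_mono' (measurableSet_Ioi.prod measurableSet_Ioo) hle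
    _ = ∫⁻ r in Set.Ioi (0 : ℝ), ∫⁻ θ in Set.Ioo (-π) π, G (r, θ) := by
        rw [Measure.volume_eq_prod, ← Measure.prod_restrict, lintegral_prod _ hGm.aemeasurable]
    _ ≤ ∫⁻ r in Set.Ioi (0 : ℝ), (Set.Ioo (0 : ℝ) 1).indicator
          (fun r => ENNReal.ofReal (r * weightBeta β η (r ^ 2))) r *
          ENNReal.ofReal (2 * π * ∑ n ∈ Finset.range N, ‖v n‖ ^ 2) := by
        apply lintegral_mono
        intro r
        simp only [hG]
        rw [lintegral_const_mul' _ _ (by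
          simp only [Set.indicator]; split_ifs <;> simp)]
        by_cases h : r ∈ Set.Ioo (0 : ℝ) 1
        · gcongr
          exact circle_lint hI N v r h.1.le h.2.le
        · simp [Set.indicator_of_notMem h]
    _ = (∫⁻ r in Set.Ioi (0 : ℝ), (Set.Ioo (0 : ℝ) 1).indicator
          (fun r => ENNReal.ofReal (r * weightBeta β η (r ^ 2))) r) *
          ENNReal.ofReal (2 * π * ∑ n ∈ Finset.range N, ‖v n‖ ^ 2) :=
        lintegral_mul_const' _ _ ENNReal.ofReal_ne_top
    _ ≤ _ := by
        refine mul_le_mul' ?_ le_rfl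
        refine (setLIntegral_le_lintegral _ _).trans ?_
        rw [lintegral_indicator measurableSet_Ioo]

lemma Sdual_hasSum {α : ℝ} (hα : -1 < α) {y M : ℝ} (hM0 : 0 ≤ M)
    (hM : ∀ n, lagPhi α n y ^ 2 ≤ M) (φ : ℝ → ℍ[ℝ])
    (hφ : AEStronglyMeasurable (fun x => √(lagW α x) • φ x) (volume.restrict (Set.Ioi 0)))
    (h2 : Integrable (fun x => ‖√(lagW α x) • φ x‖ ^ 2) (volume.restrict (Set.Ioi 0)))
    (q : ℍ[ℝ]) (hq : ‖q‖ < 1) :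
    HasSum (fun n => q ^ n * (lagPhi α n y • ∫ x in Set.Ioi (0 : ℝ),
      lagE α n x • (√(lagW α x) • φ x))) (Sdual α y φ q) := by
  set Φ : ℝ → ℍ[ℝ] := fun x => √(lagW α x) • φ x with hΦ
  have hEm : ∀ n, AEStronglyMeasurable (lagE α n) (volume.restrict (Set.Ioi 0)) :=
    fun n => (lagE_meas α n).aestronglyMeasurable
  have hI := fun n => integrable_smul_of_sq (hEm n) hφ (orth_E hα n n).1 h2
  set F : ℕ → ℝ → ℍ[ℝ] := fun n x => (lagPhi α n y • q ^ n) * (lagE α n x • Φ x) with hF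
  have hFint : ∀ n, Integrable (F n) (volume.restrict (Set.Ioi 0)) := fun n =>
    (hI n).1.const_mul _
  have hFsum : Summable fun n => ∫ x in Set.Ioi (0 : ℝ), ‖F n x‖ := by
    have hg : Summable fun n : ℕ => (√M * (1 + ∫ x in Set.Ioi (0 : ℝ), ‖Φ x‖ ^ 2)) * ‖q‖ ^ n :=
      (summable_geometric_of_lt_one (norm_nonneg _) hq).mul_left _
    refine Summable.of_nonneg_of_le (fun n => integral_nonneg fun x => norm_nonneg _) (fun n => ?_) hg
    have h3 : ∀ x, ‖F n x‖ = (|lagPhi α n y| * ‖q‖ ^ n) * ‖lagE α n x • Φ x‖ := by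
      intro x
      simp only [hF]
      rw [norm_mul, norm_smul, norm_pow, Real.norm_eq_abs]
    simp only [h3]
    rw [integral_const_mul]
    have h4 := (hI n).2
    rw [(orth_E hα n n).2, if_pos rfl] at h4
    have h5 : |lagPhi α n y| ≤ √M := Real.abs_le_sqrt (hM n)
    have h6 : 0 ≤ ∫ x in Set.Ioi (0 : ℝ), ‖lagE α n x • Φ x‖ :=
      integral_nonneg fun x => norm_nonneg _
    calc _ ≤ (√M * ‖q‖ ^ n) * (1 + ∫ x in Set.Ioi (0 : ℝ), ‖Φ x‖ ^ 2) := by gcongr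
      _ = _ := by ring
  have key := hasSum_integral_of_summable_integral_norm hFint hFsum
  have hS : Sdual α y φ q = ∫ x in Set.Ioi (0 : ℝ), ∑' n, F n x := by
    unfold Sdual
    refine setIntegral_congr_fun measurableSet_Ioi fun x hx => ?_
    change (x ^ α * Real.exp (-x)) • (Rker α q x y * φ x) = ∑' n, F n x
    unfold Rker
    rw [← tsum_mul_right, ← tsum_const_smul'']
    refine tsum_congr fun n => ?_
    simp only [hF, hΦ, lagE]
    rw [smul_smul, smul_mul_assoc, smul_mul_assoc, mul_smul_comm, smul_smul, smul_smul]
    congr 1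
    have := Real.mul_self_sqrt (lagW_nonneg (α := α) hx)
    change lagW α x * _ = _
    linear_combination (-(lagPhi α n x * lagPhi α n y)) * this
  rw [hS]
  have hterm : (fun n => q ^ n * (lagPhi α n y • ∫ x in Set.Ioi (0 : ℝ), lagE α n x • Φ x))
      = fun n => ∫ x in Set.Ioi (0 : ℝ), F n x := by
    funext n
    change _ = ∫ x in Set.Ioi (0 : ℝ), (lagPhi α n y • q ^ n) * (lagE α n x • Φ x)
    rw [integral_const_mul_of_integrable (hI n).1, mul_smul_comm, smul_mul_assoc]
  change HasSum (fun n => q ^ n * (lagPhi α n y • ∫ x in Set.Ioi (0 : ℝ), lagE α n x • Φ x)) _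
  rw [hterm]
  exact key

/-- Boundedness of `S_y^α : L^{2,α}(ℝ₊;ℍ) → L^{2,ω_{β,η}}(𝔹_I)` for every `y > 0`. -/
theorem stmt_7 (α β η : ℝ) (hα : -1 < α) (hβ : 0 < β) (hη : 0 < η)
    (y : ℝ) (hy : 0 < y) (I : ℍ[ℝ]) (hI : I ^ 2 = -1) :
    ∃ C : ℝ, 0 < C ∧ ∀ φ : ℝ → ℍ[ℝ],
      AEStronglyMeasurable φ (volume.restrict (Set.Ioi 0)) →
      (∫⁻ x in Set.Ioi (0 : ℝ),
        ENNReal.ofReal (‖φ x‖ ^ 2 * (x ^ α * Real.exp (-x)))) < ⊤ →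
      (∫⁻ p in {p : ℝ × ℝ | p.1 ^ 2 + p.2 ^ 2 < 1},
        ENNReal.ofReal (‖Sdual α y φ ((p.1 : ℍ[ℝ]) + p.2 • I)‖ ^ 2 *
          weightBeta β η (p.1 ^ 2 + p.2 ^ 2))) ≤
      ENNReal.ofReal C *
        ∫⁻ x in Set.Ioi (0 : ℝ),
          ENNReal.ofReal (‖φ x‖ ^ 2 * (x ^ α * Real.exp (-x))) := by
  obtain ⟨M, hM0, hM⟩ := lagPhi_bdd hα hy
  set K := ∫⁻ r in Set.Ioo (0 : ℝ) 1, ENNReal.ofReal (r * weightBeta β η (r ^ 2)) with hK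
  have hKfin : K < ⊤ := beta_fin hβ hη
  have hpi := Real.pi_pos
  refine ⟨K.toReal * (2 * π * M) + 1, by positivity, fun φ hφ hfin => ?_⟩
  set J := ∫⁻ x in Set.Ioi (0 : ℝ),
        ENNReal.ofReal (‖φ x‖ ^ 2 * (x ^ α * Real.exp (-x))) with hJ
  set Φ : ℝ → ℍ[ℝ] := fun x => √(lagW α x) • φ x with hΦdef
  have hWm : Measurable fun x => √(lagW α x) := by unfold lagW; fun_prop
  have hΦ : AEStronglyMeasurable Φ (volume.restrict (Set.Ioi 0)) :=
    hWm.aestronglyMeasurable.smul hφ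
  have hJ' : ∫⁻ x in Set.Ioi (0 : ℝ), ENNReal.ofReal (‖Φ x‖ ^ 2) = J := by
    refine setLIntegral_congr_fun measurableSet_Ioi fun x hx => ?_
    have := Real.sq_sqrt (lagW_nonneg (α := α) hx)
    simp only [hΦdef]
    rw [norm_smul, mul_pow, Real.norm_eq_abs, sq_abs, this, mul_comm]
    rfl
  have h2 : Integrable (fun x => ‖Φ x‖ ^ 2) (volume.restrict (Set.Ioi 0)) := by
    refine ⟨hΦ.norm.pow 2, ?_⟩
    rw [hasFiniteIntegral_iff_ofReal (Filter.Eventually.of_forall fun _ => sq_nonneg _), hJ']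
    exact hfin
  have hJ2 : ENNReal.ofReal (∫ x in Set.Ioi (0 : ℝ), ‖Φ x‖ ^ 2) = J := by
    rw [ofReal_integral_eq_lintegral_ofReal h2 (Filter.Eventually.of_forall fun _ => sq_nonneg _),
      hJ']
  set v : ℕ → ℍ[ℝ] := fun n => lagPhi α n y • ∫ x in Set.Ioi (0 : ℝ), lagE α n x • Φ x with hv
  have hvsum : ∀ N, ∑ n ∈ Finset.range N, ‖v n‖ ^ 2
      ≤ M * ∫ x in Set.Ioi (0 : ℝ), ‖Φ x‖ ^ 2 := by
    intro N
    have hb := bessel_ineq (fun n => (lagE_meas α n).aestronglyMeasurable) hΦ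
      (fun m n => (orth_E hα m n).1) (fun m n => (orth_E hα m n).2) h2 N
    refine le_trans ?_ (mul_le_mul_of_nonneg_left hb hM0)
    rw [Finset.mul_sum]
    refine Finset.sum_le_sum fun n _ => ?_
    simp only [hv]
    rw [norm_smul, mul_pow, Real.norm_eq_abs, sq_abs]
    exact mul_le_mul_of_nonneg_right (hM n) (sq_nonneg _)
  set f : ℕ → ℝ × ℝ → ENNReal := fun N p =>
      ENNReal.ofReal (‖∑ n ∈ Finset.range N, ((p.1 : ℍ[ℝ]) + p.2 • I) ^ n * v n‖ ^ 2 *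
          weightBeta β η (p.1 ^ 2 + p.2 ^ 2)) with hf
  have hfm : ∀ N, Measurable (f N) := by
    intro N
    have h1 : Continuous fun p : ℝ × ℝ =>
        ‖∑ n ∈ Finset.range N, ((p.1 : ℍ[ℝ]) + p.2 • I) ^ n * v n‖ ^ 2 := by
      have : Continuous (fun x : ℝ => (x : ℍ[ℝ])) := Quaternion.continuous_coe
      fun_prop
    have h3 : Measurable fun p : ℝ × ℝ => weightBeta β η (p.1 ^ 2 + p.2 ^ 2) :=
      (weightBeta_meas β η).comp (by fun_prop)
    exact (h1.measurable.mul h3).ennreal_ofReal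
  have hlim : ∀ p ∈ {p : ℝ × ℝ | p.1 ^ 2 + p.2 ^ 2 < 1},
      ENNReal.ofReal (‖Sdual α y φ ((p.1 : ℍ[ℝ]) + p.2 • I)‖ ^ 2 *
          weightBeta β η (p.1 ^ 2 + p.2 ^ 2)) = Filter.liminf (fun N => f N p) Filter.atTop := by
    intro p hp
    have hp : p.1 ^ 2 + p.2 ^ 2 < 1 := hp
    have hq : ‖(p.1 : ℍ[ℝ]) + p.2 • I‖ < 1 := by
      obtain ⟨h0, h1⟩ := unit_facts hI
      have h3 : ‖(p.1 : ℍ[ℝ]) + p.2 • I‖ ^ 2 = p.1 ^ 2 + p.2 ^ 2 := by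
        rw [sq, ← Quaternion.normSq_eq_norm_mul_self, Quaternion.normSq_def']
        simp [h0]
        linear_combination p.2 ^ 2 * h1
      rw [← h3] at hp
      exact (sq_lt_one_iff₀ (norm_nonneg _)).1 hp
    have hs := (Sdual_hasSum hα hM0 hM φ hΦ h2 _ hq).tendsto_sum_nat
    symm
    apply Filter.Tendsto.liminf_eq
    exact ENNReal.tendsto_ofReal ((hs.norm.pow 2).mul_const _)
  rw [setLIntegral_congr_fun disc_meas hlim]
  refine (lintegral_liminf_le hfm).trans ?_
  have hbd : ∀ N, ∫⁻ p in {p : ℝ × ℝ | p.1 ^ 2 + p.2 ^ 2 < 1}, f N p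
      ≤ ENNReal.ofReal (K.toReal * (2 * π * M) + 1) * J := by
    intro N
    refine (disc_lint hI β η N v).trans ?_
    rw [← hK, ← hJ2, ← ENNReal.ofReal_toReal hKfin.ne,
      ← ENNReal.ofReal_mul ENNReal.toReal_nonneg, ENNReal.toReal_ofReal ENNReal.toReal_nonneg,
      ← ENNReal.ofReal_mul (by positivity)]
    apply ENNReal.ofReal_le_ofReal
    have hJ0 : 0 ≤ ∫ x in Set.Ioi (0 : ℝ), ‖Φ x‖ ^ 2 := integral_nonneg fun _ => sq_nonneg _
    have hk0 : 0 ≤ K.toReal := ENNReal.toReal_nonneg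
    calc K.toReal * (2 * π * ∑ n ∈ Finset.range N, ‖v n‖ ^ 2)
        ≤ K.toReal * (2 * π * (M * ∫ x in Set.Ioi (0 : ℝ), ‖Φ x‖ ^ 2)) := by
          gcongr
          exact hvsum N
      _ ≤ _ := by linarith
  refine (Filter.liminf_le_liminf (Filter.Eventually.of_forall hbd)).trans ?_
  simp
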